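/- Let G be a countable amenable group, β : G ↷ Y an almost finite action on a compact totally disconnected metrizable space which is a subshift of finite type in the sense that there exists ℓ ≥ 2 and an equivariant topological embedding Y → {1,…,ℓ}^G (with the shift action). Let α : G ↷ X be an action on a compact metrizable space admitting an equivariant continuous surjection onto Y. If mdim(X, α) < m/2 for some natural number m ≥ 1, then there exists a continuous equivariant injection X → ([0,1]^m)^G. -/

import Mathlib

open scoped Pointwise ENNReal

/-- An action of a group `G` on a set `X`. -/
structure GAction (G X : Type*) [Group G] where
  act : G → X → X
  act_one : ∀ x, act 1 x = x
  act_mul : ∀ g h x, act (g * h) x = act g (act h x)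

/-- The dynamical sup-metric `d^α_F(x,y) = max_{g ∈ F} d(α_g x, α_g y)`. -/
noncomputable def dynMetric {G X : Type*} [Group G] (α : GAction G X)
    (d : X → X → ℝ) (F : Finset G) (x y : X) : ℝ :=
  ↑(F.sup fun g => (d (α.act g x) (α.act g y)).toNNReal)

/-- `widim_ε(X, d)`: minimal order of a finite open cover of mesh at most `ε`. -/
noncomputable def widim {X : Type*} [TopologicalSpace X] (d : X → X → ℝ) (ε : ℝ) : ℕ :=
  sInf {n : ℕ | ∃ 𝒰 : Finset (Set X),
    (∀ U ∈ 𝒰, IsOpen U) ∧ (∀ x : X, ∃ U ∈ 𝒰, x ∈ U) ∧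
    (∀ U ∈ 𝒰, ∀ x ∈ U, ∀ y ∈ U, d x y ≤ ε) ∧
    ∀ x : X, {U : Set X | U ∈ 𝒰 ∧ x ∈ U}.ncard ≤ n + 1}

/-- `F` is `(K, δ)`-invariant: `|KF \ F| ≤ δ |F|`. -/
def IsFolnerInv {G : Type*} [Group G] (K : Finset G) (δ : ℝ) (F : Finset G) : Prop :=
  letI := Classical.decEq G
  (((K * F) \ F).card : ℝ) ≤ δ * F.card

/-- A Følner sequence of nonempty finite subsets of `G`. -/
def IsFolnerSeq {G : Type*} [Group G] (Fseq : ℕ → Finset G) : Prop :=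
  (∀ n, (Fseq n).Nonempty) ∧
    ∀ (K : Finset G) (δ : ℝ), 0 < δ → ∃ N : ℕ, ∀ n ≥ N, IsFolnerInv K δ (Fseq n)

/-- `mdim_ε(X, α, d)` computed along the sequence `Fseq`. -/
noncomputable def mdimEps {G X : Type*} [Group G] [TopologicalSpace X] (α : GAction G X)
    (d : X → X → ℝ) (Fseq : ℕ → Finset G) (ε : ℝ) : ℝ≥0∞ :=
  Filter.atTop.limsup fun n =>
    (widim (dynMetric α d (Fseq n)) ε : ℝ≥0∞) / ((Fseq n).card : ℝ≥0∞)

/-- Mean dimension `mdim(X, α) = sup_{ε > 0} mdim_ε(X, α, d)`. -/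
noncomputable def mdim {G X : Type*} [Group G] [TopologicalSpace X] (α : GAction G X)
    (d : X → X → ℝ) (Fseq : ℕ → Finset G) : ℝ≥0∞ :=
  ⨆ (ε : ℝ) (_ : 0 < ε), mdimEps α d Fseq ε

/-- An `ε`-embedding: all fibers have diameter `< ε`. -/
def IsEpsEmbedding {X Z : Type*} [PseudoMetricSpace X] (f : X → Z) (ε : ℝ) : Prop :=
  ∀ z : Z, Metric.diam (f ⁻¹' {z}) < ε

/-- The orbit map `I_f(x) = (f(α_g(x)))_{g ∈ G}` (with the index convention making it
equivariant for the shift `σ_g((x_h)_h) = (x_{g⁻¹h})_h`). -/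
def Ifun {G X K : Type*} [Group G] (α : GAction G X) (f : X → K) (x : X) (g : G) : K :=
  f (α.act g⁻¹ x)

/-- Almost finiteness: clopen castles with arbitrarily invariant shapes partitioning the space. -/
def IsAlmostFinite {G Y : Type*} [Group G] [TopologicalSpace Y] (β : GAction G Y) : Prop :=
  ∀ (K : Finset G) (δ : ℝ), 0 < δ →
    ∃ (ι : Type) (_ : Fintype ι) (W : ι → Set Y) (S : ι → Finset G),
      (∀ i, IsClopen (W i)) ∧
      (∀ i, (S i).Nonempty ∧ IsFolnerInv K δ (S i)) ∧
      (∀ i j : ι, ∀ s ∈ S i, ∀ t ∈ S j, ¬(i = j ∧ s = t) →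
        Disjoint (β.act s '' W i) (β.act t '' W j)) ∧
      (⋃ i, ⋃ s ∈ S i, β.act s '' W i) = Set.univ

/-- `d` is a metric on `X` inducing the given topology. -/
def IsCompatibleMetric {X : Type*} [TopologicalSpace X] (d : X → X → ℝ) : Prop :=
  (∀ x y, 0 ≤ d x y) ∧ (∀ x y, d x y = 0 ↔ x = y) ∧ (∀ x y, d x y = d y x) ∧
    (∀ x y z, d x z ≤ d x y + d y z) ∧
    ∀ s : Set X, IsOpen s ↔ ∀ x ∈ s, ∃ ε > 0, {y | d x y < ε} ⊆ s

/-- The shift action `σ_g((x_h)_h) = (x_{g⁻¹h})_h` of `G` on `K^G`. -/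
def shiftAction (G : Type*) [Group G] (K : Type*) : GAction G (G → K) where
  act g x h := x (g⁻¹ * h)
  act_one x := by funext h; simp
  act_mul g g' x := by funext h; simp [mul_assoc]

theorem isFolnerInv_iff {G : Type*} [Group G] [DecidableEq G] (K : Finset G) (δ : ℝ)
    (F : Finset G) : IsFolnerInv K δ F ↔ (((K * F) \ F).card : ℝ) ≤ δ * F.card := by
  unfold IsFolnerInv
  have : Classical.decEq G = ‹DecidableEq G› := Subsingleton.elim _ _
  rw [this]

theorem isFolnerInv_mono {G : Type*} [Group G] {K K' : Finset G} {δ δ' : ℝ}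
    {F : Finset G} (hK : K ⊆ K') (hδ : δ' ≤ δ) (h : IsFolnerInv K' δ' F) :
    IsFolnerInv K δ F := by
  classical
  rw [isFolnerInv_iff] at *
  calc (((K * F) \ F).card : ℝ) ≤ ((K' * F) \ F).card := by
        exact_mod_cast Finset.card_le_card
          (Finset.sdiff_subset_sdiff (Finset.mul_subset_mul_right hK) le_rfl)
    _ ≤ δ' * F.card := h
    _ ≤ δ * F.card := by gcongr

theorem mem_mul_sing {G : Type*} [Group G] [DecidableEq G] (F : Finset G) (c u : G) :
    u ∈ F * {c} ↔ ∃ f ∈ F, f * c = u := by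
  simp only [Finset.mem_mul, Finset.mem_singleton]
  constructor
  · rintro ⟨f, hf, _, rfl, h⟩; exact ⟨f, hf, h⟩
  · rintro ⟨f, hf, h⟩; exact ⟨f, hf, c, rfl, h⟩

theorem card_mul_sing {G : Type*} [Group G] [DecidableEq G] (F : Finset G) (c : G) :
    (F * {c}).card = F.card := by
  have : F * {c} = F.image (fun f => f * c) := by
    ext u; rw [mem_mul_sing, Finset.mem_image]
  rw [this]
  exact Finset.card_image_of_injective _ (mul_left_injective c)

theorem double_count {G : Type*} [Group G] [DecidableEq G] (F good V : Finset G) :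
    ∑ c ∈ good, (((F * {c}) ∩ V).card) ≤ F.card * V.card := by
  calc ∑ c ∈ good, (((F * {c}) ∩ V).card)
      = ∑ c ∈ good, ∑ u ∈ V, (if u ∈ F * {c} then 1 else 0) := by
        refine Finset.sum_congr rfl fun c _ => ?_
        rw [← Finset.card_filter]
        congr 1
        ext u
        rw [Finset.mem_inter, Finset.mem_filter, and_comm]
    _ = ∑ u ∈ V, ∑ c ∈ good, (if u ∈ F * {c} then 1 else 0) := Finset.sum_comm
    _ ≤ ∑ u ∈ V, F.card := by
        refine Finset.sum_le_sum fun u _ => ?_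
        rw [← Finset.card_filter]
        calc (good.filter fun c => u ∈ F * {c}).card ≤ (F.image fun f => f⁻¹ * u).card := by
              refine Finset.card_le_card fun c hc => ?_
              have := (Finset.mem_filter.1 hc).2
              rw [mem_mul_sing] at this
              obtain ⟨f, hf, rfl⟩ := this
              exact Finset.mem_image.2 ⟨f, hf, by simp⟩
          _ ≤ _ := Finset.card_image_le
    _ = _ := by rw [Finset.sum_const, smul_eq_mul, mul_comm]

set_option maxHeartbeats 1000000 in
theorem exists_centers {G : Type*} [Group G] [DecidableEq G] (F S : Finset G) (ε : ℝ)
    (hε0 : 0 < ε) (hε1 : ε < 1) (hinv : IsFolnerInv F (1 / (2 * (F.card : ℝ))) S)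
    (hF : F.Nonempty) :
    ∃ D : Finset G, (∀ c ∈ D, F * {c} ⊆ S) ∧
      (1 - ε) * (D.card * F.card) ≤ ((D.biUnion fun c => F * {c}).card : ℝ) ∧
      ε / 2 * S.card ≤ ((D.biUnion fun c => F * {c}).card : ℝ) := by
  set good := S.filter (fun c => F * {c} ⊆ S) with hgood
  obtain ⟨U, hU⟩ : ∃ U : Finset G → Finset G, ∀ D, U D = D.biUnion fun c => F * {c} :=
    ⟨_, fun _ => rfl⟩
  simp only [← hU]
  let fam := good.powerset.filter
    (fun D => (1 - ε) * (D.card * F.card) ≤ ((U D).card : ℝ))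
  have hfam : fam.Nonempty := ⟨∅, by simp [fam, hU]⟩
  obtain ⟨D, hD, hmax⟩ := Finset.exists_max_image fam Finset.card hfam
  have hFpos : (0 : ℝ) < F.card := by exact_mod_cast hF.card_pos
  have hD1 : D ⊆ good := by
    have := (Finset.mem_filter.1 hD).1
    exact Finset.mem_powerset.1 this
  have hD2 : (1 - ε) * (D.card * F.card) ≤ ((U D).card : ℝ) := (Finset.mem_filter.1 hD).2
  have hD0 : ∀ c ∈ D, F * {c} ⊆ S := fun c hc => (Finset.mem_filter.1 (hD1 hc)).2
  refine ⟨D, hD0, hD2, ?_⟩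
  -- each good c
  have key : ∀ c ∈ good, ε * F.card ≤ (((F * {c}) ∩ U D).card : ℝ) := by
    intro c hc
    have hcard : (F * {c}).card = F.card := card_mul_sing F c
    by_cases hcD : c ∈ D
    · have : F * {c} ⊆ U D := by
        intro u hu
        rw [hU, Finset.mem_biUnion]
        exact ⟨c, hcD, hu⟩
      rw [Finset.inter_eq_left.2 this, hcard]
      nlinarith
    · by_contra hlt
      push Not at hlt
      have hnew : insert c D ∈ fam := by
        refine Finset.mem_filter.2 ⟨Finset.mem_powerset.2 (Finset.insert_subset hc hD1), ?_⟩
        have h1 : U (insert c D) = (F * {c}) ∪ U D := by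
          rw [hU, hU, Finset.biUnion_insert]
        have h2 := Finset.card_union_add_card_inter (F * {c}) (U D)
        have h3 : (((F * {c}) ∪ U D).card : ℝ) + ((F * {c}) ∩ U D).card
            = F.card + (U D).card := by
          rw [hcard] at h2; exact_mod_cast h2
        rw [h1, Finset.card_insert_of_notMem hcD]
        push_cast
        nlinarith
      have := hmax _ hnew
      rw [Finset.card_insert_of_notMem hcD] at this
      omega
  have hdc := double_count F good (U D)
  have h1 : ε * F.card * good.card ≤ F.card * (U D).card := by
    have : ∑ c ∈ good, ε * (F.card : ℝ) ≤ ∑ c ∈ good, (((F * {c}) ∩ U D).card : ℝ) :=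
      Finset.sum_le_sum key
    rw [Finset.sum_const, nsmul_eq_mul] at this
    have h' : (∑ c ∈ good, (((F * {c}) ∩ U D).card : ℝ)) ≤ F.card * (U D).card := by
      exact_mod_cast hdc
    linarith
  have h2 : ε * good.card ≤ ((U D).card : ℝ) := by
    have : F.card * (ε * good.card) ≤ F.card * ((U D).card : ℝ) := by linarith
    exact le_of_mul_le_mul_left this hFpos
  -- bad
  have hbad : ((S \ good).card : ℝ) ≤ S.card / 2 := by
    rw [isFolnerInv_iff] at hinv
    have hsub : S \ good ⊆ F⁻¹ * ((F * S) \ S) := by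
      intro c hc
      rw [Finset.mem_sdiff] at hc
      have hcn : ¬ (F * {c} ⊆ S) := fun h => hc.2 (Finset.mem_filter.2 ⟨hc.1, h⟩)
      rw [Finset.not_subset] at hcn
      obtain ⟨u, hu, huS⟩ := hcn
      rw [mem_mul_sing] at hu
      obtain ⟨f, hf, rfl⟩ := hu
      refine Finset.mem_mul.2 ⟨f⁻¹, Finset.inv_mem_inv hf, f * c, ?_, by simp⟩
      exact Finset.mem_sdiff.2 ⟨Finset.mul_mem_mul hf hc.1, huS⟩
    have h3 : (S \ good).card ≤ F.card * ((F * S) \ S).card := by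
      calc _ ≤ _ := Finset.card_le_card hsub
        _ ≤ F⁻¹.card * ((F * S) \ S).card := Finset.card_mul_le
        _ = _ := by rw [Finset.card_inv]
    have h4 : ((S \ good).card : ℝ) ≤ F.card * (((F * S) \ S).card : ℝ) := by exact_mod_cast h3
    calc ((S \ good).card : ℝ) ≤ F.card * (((F * S) \ S).card : ℝ) := h4
      _ ≤ F.card * (1 / (2 * (F.card : ℝ)) * S.card) := by gcongr
      _ = S.card / 2 := by field_simp
  have h5 : ((S \ good).card : ℝ) = S.card - good.card := by
    rw [Finset.card_sdiff_of_subset (Finset.filter_subset _ _),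
      Nat.cast_sub (Finset.card_le_card (Finset.filter_subset _ _))]
  have : (S.card : ℝ) / 2 ≤ good.card := by linarith
  nlinarith

/-- invariance of the remainder -/
theorem remainder_inv {G : Type*} [Group G] [DecidableEq G] (K F S D : Finset G)
    (δ₁ δ₂ : ℝ) (hS : IsFolnerInv K δ₁ S) (hF : IsFolnerInv K⁻¹ δ₂ F) :
    (((K * (S \ D.biUnion fun c => F * {c})) \ (S \ D.biUnion fun c => F * {c})).card : ℝ) ≤
      δ₁ * S.card + K.card * (D.card * (δ₂ * F.card)) := by
  set U := D.biUnion fun c => F * {c} with hU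
  rw [isFolnerInv_iff] at hS hF
  have hsub : (K * (S \ U)) \ (S \ U) ⊆
      ((K * S) \ S) ∪ K * (D.biUnion fun c => ((K⁻¹ * F) \ F) * {c}) := by
    intro u hu
    rw [Finset.mem_sdiff, Finset.mem_mul] at hu
    obtain ⟨⟨k, hk, a, ha, rfl⟩, hn⟩ := hu
    rw [Finset.mem_sdiff] at ha
    rw [Finset.mem_union]
    by_cases hS' : k * a ∈ S
    · right
      have hkU : k * a ∈ U := by
        by_contra h
        exact hn (Finset.mem_sdiff.2 ⟨hS', h⟩)
      rw [hU, Finset.mem_biUnion] at hkU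
      obtain ⟨c, hc, hkc⟩ := hkU
      refine Finset.mul_mem_mul hk (Finset.mem_biUnion.2 ⟨c, hc, ?_⟩)
      rw [mem_mul_sing] at hkc ⊢
      obtain ⟨f, hf, hfc⟩ := hkc
      refine ⟨a * c⁻¹, Finset.mem_sdiff.2 ⟨?_, ?_⟩, by simp⟩
      · refine Finset.mem_mul.2 ⟨k⁻¹, Finset.inv_mem_inv hk, f, hf, ?_⟩
        have : f = k * a * c⁻¹ := by rw [← hfc]; simp
        rw [this]; group
      · intro hac
        apply ha.2
        rw [hU]
        refine Finset.mem_biUnion.2 ⟨c, hc, ?_⟩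
        rw [mem_mul_sing]
        exact ⟨_, hac, by simp⟩
    · left
      exact Finset.mem_sdiff.2 ⟨Finset.mul_mem_mul hk ha.1, hS'⟩
  have h1 : ((K * (S \ U)) \ (S \ U)).card ≤
      ((K * S) \ S).card + K.card * (D.card * ((K⁻¹ * F) \ F).card) := by
    calc _ ≤ _ := Finset.card_le_card hsub
      _ ≤ _ := Finset.card_union_le _ _
      _ ≤ _ := by
        gcongr
        refine Finset.card_mul_le.trans ?_
        gcongr
        refine Finset.card_biUnion_le_card_mul _ _ _ fun c _ => ?_
        refine Finset.card_mul_le.trans ?_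
        simp
  calc (((K * (S \ U)) \ (S \ U)).card : ℝ)
      ≤ ((K * S) \ S).card + K.card * (D.card * ((K⁻¹ * F) \ F).card) := by exact_mod_cast h1
    _ ≤ _ := by gcongr

set_option maxHeartbeats 1000000 in
theorem ornstein_weiss {G : Type*} [Group G] [DecidableEq G] (H : Finset G → ℝ)
    (hHe : H ∅ = 0)
    (hsub : ∀ A B, H (A ∪ B) ≤ H A + H B) (htr : ∀ A c, H (A * {c}) ≤ H A)
    (C : ℝ) (hC : ∀ A, H A ≤ C * A.card)
    (Fseq : ℕ → Finset G) (hFseq : IsFolnerSeq Fseq) (θ : ℝ) (hθ : 0 ≤ θ) (M : ℕ)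
    (hθF : ∀ n ≥ M, H (Fseq n) ≤ θ * (Fseq n).card) (θ' : ℝ) (hθ' : θ < θ') :
    ∃ (K : Finset G) (δ : ℝ), 0 < δ ∧ ∀ S, IsFolnerInv K δ S → H S ≤ θ' * S.card := by
  have hbi : ∀ (D : Finset G) (F : Finset G), H (D.biUnion fun c => F * {c}) ≤ D.card * H F := by
    intro D F
    induction D using Finset.induction_on with
    | empty => simp [hHe]
    | insert a D ha ih =>
      rw [Finset.biUnion_insert, Finset.card_insert_of_notMem ha]
      have := hsub (F * {a}) (D.biUnion fun c => F * {c})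
      have := htr F a
      push_cast
      linarith
  set Λ : Set ℝ := {t | 0 ≤ t ∧ ∃ (K : Finset G) (δ : ℝ), 0 < δ ∧
    ∀ S, IsFolnerInv K δ S → H S ≤ t * S.card} with hΛ
  have hne : Λ.Nonempty := by
    refine ⟨max C 0, le_max_right _ _, ∅, 1, one_pos, fun S _ => (hC S).trans ?_⟩
    gcongr; exact le_max_left _ _
  have hbdd : BddBelow Λ := ⟨0, fun t ht => ht.1⟩
  by_cases hlt : sInf Λ < θ'
  · obtain ⟨t, ⟨_, K, δ, hδ, h⟩, htθ⟩ := exists_lt_of_csInf_lt hne hlt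
    exact ⟨K, δ, hδ, fun S hS => (h S hS).trans (by gcongr)⟩
  exfalso
  push Not at hlt
  set lam := sInf Λ with hlam
  set g := (lam - θ) / 2 with hg
  have hgpos : 0 < g := by rw [hg]; linarith
  have hlpos : 0 < lam := by linarith
  -- choose ε
  set ε := g / (2 * lam) with hε
  have hεpos : 0 < ε := by positivity
  have hε2 : ε ≤ 1 / 4 := by
    rw [hε, div_le_div_iff₀ (by positivity) (by norm_num)]; linarith
  have hεg : θ ≤ (lam - g) * (1 - ε) := by
    have h1 : lam - g = θ + g := by rw [hg]; ring
    have h2 : lam * ε = g / 2 := by rw [hε]; field_simp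
    nlinarith
  have hlg : 0 ≤ lam - g := by rw [hg]; linarith
  obtain ⟨t, ⟨ht0, K, δ, hδ, h⟩, htl⟩ : ∃ t ∈ Λ, t < lam + g * ε / 4 :=
    exists_lt_of_csInf_lt hne (by rw [← hlam]; have : 0 < g * ε := by positivity
                                  linarith)
  have htlam : lam ≤ t := csInf_le hbdd ⟨ht0, K, δ, hδ, h⟩
  set C' := max C 0 + 1 with hC'
  have hC'pos : 0 < C' := by have := le_max_right C 0; linarith
  have hCC' : ∀ A, H A ≤ C' * A.card := fun A => (hC A).trans (by
    gcongr; have := le_max_left C 0; linarith)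
  set ρ := g / (2 * C') with hρ
  have hρpos : 0 < ρ := by positivity
  have hCρ : C' * ρ = g / 2 := by rw [hρ]; field_simp
  obtain ⟨N, hN⟩ := hFseq.2 K⁻¹ (δ * ρ / (4 * (K.card + 1))) (by positivity)
  have hFθ := hθF _ (le_max_left M N)
  have hFinv := hN _ (le_max_right M N)
  have hFne := hFseq.1 (max M N)
  generalize Fseq (max M N) = F at hFθ hFinv hFne
  have hFpos : (0 : ℝ) < F.card := by exact_mod_cast hFne.card_pos
  have hmem : t - g * ε / 2 ∈ Λ := by
    refine ⟨by nlinarith, K ∪ F, min (δ * ρ / 2) (1 / (2 * (F.card : ℝ))),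
      lt_min (by positivity) (by positivity), fun S hS => ?_⟩
    have hS1 : IsFolnerInv K (δ * ρ / 2) S :=
      isFolnerInv_mono Finset.subset_union_left (min_le_left _ _) hS
    have hS2 : IsFolnerInv F (1 / (2 * (F.card : ℝ))) S :=
      isFolnerInv_mono Finset.subset_union_right (min_le_right _ _) hS
    obtain ⟨D, hD1, hD2, hD3⟩ := exists_centers F S ε hεpos (by linarith) hS2 hFne
    have hrem := remainder_inv K F S D _ _ hS1 hFinv
    have hHU := hbi D F
    have hUS : (D.biUnion fun c => F * {c}) ⊆ S := Finset.biUnion_subset.2 hD1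
    generalize (D.biUnion fun c => F * {c}) = U at hUS hHU hrem hD2 hD3
    have hSU : H S ≤ H U + H (S \ U) := by
      have := hsub U (S \ U)
      rwa [Finset.union_sdiff_of_subset hUS] at this
    have hcard : ((S \ U).card : ℝ) = S.card - U.card := by
      rw [Finset.card_sdiff_of_subset hUS, Nat.cast_sub (Finset.card_le_card hUS)]
    have hUScard : (U.card : ℝ) ≤ S.card := by exact_mod_cast Finset.card_le_card hUS
    have hHU2 : H U ≤ (lam - g) * U.card := by
      calc H U ≤ D.card * H F := hHU
        _ ≤ D.card * (θ * F.card) := by gcongr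
        _ ≤ D.card * (((lam - g) * (1 - ε)) * F.card) := by gcongr
        _ = (lam - g) * ((1 - ε) * (D.card * F.card)) := by ring
        _ ≤ _ := by gcongr
    have hS0 : (0 : ℝ) ≤ S.card := by positivity
    have hU0 : (0 : ℝ) ≤ U.card := by positivity
    by_cases hcase : ((S \ U).card : ℝ) ≤ ρ * S.card
    · have h1 : H (S \ U) ≤ g / 2 * S.card := by
        calc _ ≤ C' * (S \ U).card := hCC' _
          _ ≤ C' * (ρ * S.card) := by gcongr
          _ = _ := by rw [← hCρ]; ring
      have h2 : (lam - g) * U.card ≤ (lam - g) * S.card := by gcongr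
      have h3 : (lam - g / 2) ≤ t - g * ε / 2 := by nlinarith
      calc H S ≤ (lam - g / 2) * S.card := by linarith
        _ ≤ _ := by gcongr
    · push Not at hcase
      have hinv : IsFolnerInv K δ (S \ U) := by
        rw [isFolnerInv_iff]
        have h1 : (D.card * F.card : ℝ) ≤ 2 * S.card := by
          have : (0 : ℝ) ≤ D.card * F.card := by positivity
          nlinarith
        have h2 : (K.card : ℝ) / (K.card + 1) ≤ 1 := by
          rw [div_le_one (by positivity)]; linarith
        refine hrem.trans ?_
        calc δ * ρ / 2 * S.card + K.card * (D.card * (δ * ρ / (4 * (K.card + 1)) * F.card))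
            = δ * ρ / 2 * S.card + (δ * ρ / 4) * ((K.card : ℝ) / (K.card + 1)) *
              (D.card * F.card) := by field_simp
          _ ≤ δ * ρ / 2 * S.card + (δ * ρ / 4) * 1 * (2 * S.card) := by gcongr
          _ = δ * (ρ * S.card) := by ring
          _ ≤ _ := by gcongr
      have h1 := h _ hinv
      rw [hcard] at h1
      have h4 : g * (ε / 2 * S.card) ≤ g * U.card := by gcongr
      have h5 : lam * U.card ≤ t * U.card := by gcongr
      nlinarith
  have := csInf_le hbdd hmem
  rw [← hlam] at this
  have : 0 < g * ε := by positivity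
  linarith

universe u

theorem exists_generic {E : Type*} [NormedAddCommGroup E] [NormedSpace ℝ E]
    [FiniteDimensional ℝ E] {P : Type*} [DecidableEq P] (w : P → E) (κ : ℝ) (hκ : 0 < κ)
    (A : Finset P) :
    ∃ v : P → E, (∀ p, ‖v p - w p‖ < κ) ∧
      ∀ (T : Finset P) (a : P → ℝ), T ⊆ A → T.card ≤ Module.finrank ℝ E + 1 →
        ∑ p ∈ T, a p = 0 → ∑ p ∈ T, a p • v p = 0 → ∀ p ∈ T, a p = 0 := by
  classical
  induction A using Finset.induction_on with
  | empty =>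
    refine ⟨w, fun p => by simpa using hκ, fun T a hT _ _ _ p hp => ?_⟩
    exact absurd (hT hp) (by simp)
  | insert q A hq ih =>
    obtain ⟨v, hv1, hv2⟩ := ih
    let _ : MeasurableSpace E := borel E
    have : BorelSpace E := ⟨rfl⟩
    let Bad : Finset (Finset P) := A.powerset.filter (fun T => T.card ≤ Module.finrank ℝ E)
    have hbad : ∀ T ∈ Bad, affineSpan ℝ (v '' (T : Set P)) ≠ ⊤ := by
      intro T hT htop
      have hc := (Finset.mem_filter.1 hT).2
      rcases Nat.eq_zero_or_pos T.card with h0 | hpos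
      · rw [Finset.card_eq_zero] at h0
        subst h0
        simp at htop
      · obtain ⟨n, hn⟩ : ∃ n, T.card = n + 1 := ⟨T.card - 1, by omega⟩
        have h1 := finrank_vectorSpan_image_finset_le ℝ v T hn
        have h2 : vectorSpan ℝ ((T.image v : Finset E) : Set E) = ⊤ := by
          rw [Finset.coe_image, ← direction_affineSpan, htop, AffineSubspace.direction_top]
        rw [h2, finrank_top] at h1
        omega
    have hnull : MeasureTheory.Measure.addHaar
        (⋃ T ∈ Bad, ((affineSpan ℝ (v '' (T : Set P)) : AffineSubspace ℝ E) : Set E)) = 0 := by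
      refine (MeasureTheory.measure_biUnion_null_iff Bad.countable_toSet).2 ?_
      intro T hT
      exact MeasureTheory.Measure.addHaar_affineSubspace _ _ (hbad T hT)
    obtain ⟨z, hz1, hz2⟩ : ∃ z ∈ Metric.ball (w q) κ,
        z ∉ (⋃ T ∈ Bad, ((affineSpan ℝ (v '' (T : Set P)) : AffineSubspace ℝ E) : Set E)) := by
      by_contra hcon
      push Not at hcon
      have h1 : 0 < (MeasureTheory.Measure.addHaar : MeasureTheory.Measure E)
          (Metric.ball (w q) κ) := Metric.measure_ball_pos _ _ hκ
      have h2 := MeasureTheory.measure_mono_null hcon hnull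
      exact h1.ne' h2
    refine ⟨Function.update v q z, ?_, ?_⟩
    · intro p
      by_cases hp : p = q
      · subst hp; simpa [dist_eq_norm] using hz1
      · rw [Function.update_of_ne hp]; exact hv1 p
    · intro T a hT hTc hs hsv
      have hother : ∀ T' : Finset P, q ∉ T' → ∑ p ∈ T', a p • Function.update v q z p
          = ∑ p ∈ T', a p • v p := fun T' hqT' => Finset.sum_congr rfl fun p hp => by
        rw [Function.update_of_ne (by rintro rfl; exact hqT' hp)]
      have hcaseA : ∀ T' : Finset P, T' ⊆ insert q A → q ∉ T' → T' ⊆ A := by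
        intro T' h h' p hp
        rcases Finset.mem_insert.1 (h hp) with rfl | h2
        · exact absurd hp h'
        · exact h2
      by_cases hqT : q ∈ T
      · have hT' := Finset.insert_erase hqT
        have hne := Finset.notMem_erase q T
        have hcE := Finset.card_erase_of_mem hqT
        have hsubE : T.erase q ⊆ insert q A := (Finset.erase_subset _ _).trans hT
        generalize T.erase q = T' at hT' hne hcE hsubE
        subst hT'
        rw [Finset.sum_insert hne] at hs hsv
        rw [hother T' hne, Function.update_self] at hsv
        have hT'A := hcaseA T' hsubE hne
        have hcT' : T'.card ≤ Module.finrank ℝ E := by omega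
        have haq : a q = 0 := by
          by_contra haq
          apply hz2
          refine Set.mem_biUnion (x := T')
            (Finset.mem_filter.2 ⟨Finset.mem_powerset.2 hT'A, hcT'⟩) ?_
          have hsum1 : ∑ p ∈ T', (-(a q)⁻¹ * a p) = 1 := by
            rw [← Finset.mul_sum]
            have : ∑ p ∈ T', a p = - a q := by linarith
            rw [this]; field_simp
          have hzeq : z = ∑ p ∈ T', (-(a q)⁻¹ * a p) • v p := by
            simp_rw [mul_smul]
            rw [← Finset.smul_sum]
            have : ∑ p ∈ T', a p • v p = - (a q • z) := by
              rw [eq_neg_iff_add_eq_zero, add_comm]; exact hsv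
            rw [this, smul_neg, neg_smul, neg_neg, smul_smul, inv_mul_cancel₀ haq, one_smul]
          rw [hzeq, ← Finset.affineCombination_eq_linear_combination T' v _ hsum1]
          exact affineCombination_mem_affineSpan_image hsum1 (fun i hi hi' => absurd hi hi') v
        rw [haq] at hs hsv
        have := hv2 T' a hT'A (by omega) (by simpa using hs) (by simpa using hsv)
        intro p hp
        rcases Finset.mem_insert.1 hp with rfl | hp
        · exact haq
        · exact this p hp
      · rw [hother T hqT] at hsv
        exact hv2 T a (hcaseA T hT hqT) hTc hs hsv

/-- a system of functions adapted to `A` -/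
def Sys {G : Type*} {X : Type u} [Group G] [MetricSpace X] (α : GAction G X) (ε : ℝ)
    (A : Finset G) (q : ℕ) : Prop :=
  ∃ (P : Type u) (_ : Fintype P) (φ : P → X → ℝ) (c : ℝ) (Ps : G → Finset P),
    (∀ p, Continuous (φ p)) ∧ (∀ p x, 0 ≤ φ p x) ∧ (∀ x, ∑ p, φ p x = c) ∧
    (∀ x, {p | φ p x ≠ 0}.ncard ≤ q) ∧
    (∀ s ∈ A, ∀ x, ∑ p ∈ Ps s, φ p x = 1) ∧
    (∀ s ∈ A, ∀ p ∈ Ps s, ∀ x y, φ p x ≠ 0 → φ p y ≠ 0 →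
      dist (α.act s x) (α.act s y) ≤ ε)

theorem Sys.mono {G : Type*} {X : Type u} [Group G] [MetricSpace X] {α : GAction G X} {ε : ℝ}
    {A B : Finset G} {q : ℕ} (h : Sys α ε A q) (hBA : B ⊆ A) : Sys α ε B q := by
  obtain ⟨P, i, φ, c, Ps, h1, h2, h3, h4, h5, h6⟩ := h
  exact ⟨P, i, φ, c, Ps, h1, h2, h3, h4, fun s hs => h5 s (hBA hs), fun s hs => h6 s (hBA hs)⟩

theorem Sys.empty {G : Type*} {X : Type u} [Group G] [MetricSpace X] {α : GAction G X} {ε : ℝ} :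
    Sys α ε ∅ 0 :=
  ⟨PEmpty, inferInstance, fun p => p.elim, 0, fun _ => ∅, by simp, by simp, by simp,
    fun x => by
      rw [Set.eq_empty_of_isEmpty {p : PEmpty | (p.elim : X → ℝ) x ≠ 0}]
      simp, by simp, by simp⟩

theorem Sys.translate {G : Type*} {X : Type u} [Group G] [DecidableEq G] [MetricSpace X]
    {α : GAction G X} (hα : ∀ g, Continuous (α.act g)) {ε : ℝ}
    {A : Finset G} {q : ℕ} (h : Sys α ε A q) (g : G) : Sys α ε (A * {g}) q := by
  obtain ⟨P, i, φ, c, Ps, h1, h2, h3, h4, h5, h6⟩ := h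
  refine ⟨P, i, fun p x => φ p (α.act g x), c, fun s => Ps (s * g⁻¹), fun p => (h1 p).comp (hα g),
    fun p x => h2 p _, fun x => h3 _, fun x => h4 _, ?_, ?_⟩
  · intro s hs x
    obtain ⟨f, hf, rfl⟩ := (mem_mul_sing _ _ _).1 hs
    simpa using h5 f hf (α.act g x)
  · intro s hs p hp x y hx hy
    obtain ⟨f, hf, rfl⟩ := (mem_mul_sing _ _ _).1 hs
    rw [α.act_mul, α.act_mul]
    exact h6 f hf p (by simpa using hp) _ _ hx hy

theorem Sys.union {G : Type*} {X : Type u} [Group G] [DecidableEq G] [MetricSpace X]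
    {α : GAction G X} {ε : ℝ} {A B : Finset G} {q r : ℕ} (hA : Sys α ε A q) (hB : Sys α ε B r) :
    Sys α ε (A ∪ B) (q + r) := by
  classical
  obtain ⟨P, i, φ, c, Ps, h1, h2, h3, h4, h5, h6⟩ := hA
  obtain ⟨P', i', φ', c', Ps', h1', h2', h3', h4', h5', h6'⟩ := hB
  refine ⟨P ⊕ P', inferInstance, Sum.elim φ φ', c + c',
    fun s => if s ∈ A then (Ps s).map ⟨Sum.inl, Sum.inl_injective⟩
      else (Ps' s).map ⟨Sum.inr, Sum.inr_injective⟩, ?_, ?_, ?_, ?_, ?_, ?_⟩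
  · rintro (p | p)
    · exact h1 p
    · exact h1' p
  · rintro (p | p) x
    · exact h2 p x
    · exact h2' p x
  · intro x
    simp [h3, h3']
  · intro x
    have : {p : P ⊕ P' | Sum.elim φ φ' p x ≠ 0} =
        Sum.inl '' {p | φ p x ≠ 0} ∪ Sum.inr '' {p | φ' p x ≠ 0} := by
      ext p
      rcases p with p | p <;> simp
    rw [this]
    refine (Set.ncard_union_le _ _).trans ?_
    rw [Set.ncard_image_of_injective _ Sum.inl_injective,
      Set.ncard_image_of_injective _ Sum.inr_injective]
    exact Nat.add_le_add (h4 x) (h4' x)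
  · intro s hs x
    by_cases hsA : s ∈ A
    · simp [hsA, h5 s hsA x]
    · have hsB : s ∈ B := (Finset.mem_union.1 hs).resolve_left hsA
      simp [hsA, h5' s hsB x]
  · intro s hs p hp x y hx hy
    by_cases hsA : s ∈ A
    · simp only [hsA, if_true, Finset.mem_map] at hp
      obtain ⟨p, hp, rfl⟩ := hp
      exact h6 s hsA p hp x y hx hy
    · have hsB : s ∈ B := (Finset.mem_union.1 hs).resolve_left hsA
      simp only [hsA, if_false, Finset.mem_map] at hp
      obtain ⟨p, hp, rfl⟩ := hp
      exact h6' s hsB p hp x y hx hy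

theorem dist_le_of_dynMetric {G X : Type*} [Group G] [MetricSpace X] {α : GAction G X}
    {F : Finset G} {x y : X} {ε : ℝ} (h : dynMetric α dist F x y ≤ ε) {g : G} (hg : g ∈ F) :
    dist (α.act g x) (α.act g y) ≤ ε := by
  refine le_trans ?_ h
  unfold dynMetric
  have := Finset.le_sup (f := fun g => (dist (α.act g x) (α.act g y)).toNNReal) hg
  calc dist (α.act g x) (α.act g y) ≤ ((dist (α.act g x) (α.act g y)).toNNReal : ℝ) :=
        Real.le_coe_toNNReal _
    _ ≤ _ := by exact_mod_cast this

theorem dynMetric_le {G X : Type*} [Group G] [MetricSpace X] {α : GAction G X}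
    {F : Finset G} {x y : X} {ε : ℝ} (hε : 0 ≤ ε)
    (h : ∀ g ∈ F, dist (α.act g x) (α.act g y) ≤ ε) : dynMetric α dist F x y ≤ ε := by
  unfold dynMetric
  lift ε to NNReal using hε
  norm_cast
  exact Finset.sup_le fun g hg => Real.toNNReal_le_iff_le_coe.2 (h g hg)

theorem Sys.of_cover {G : Type*} {X : Type u} [Group G] [MetricSpace X] [CompactSpace X]
    {α : GAction G X} {ε : ℝ} {A : Finset G} {n : ℕ} (𝒰 : Finset (Set X))
    (hop : ∀ U ∈ 𝒰, IsOpen U) (hcov : ∀ x : X, ∃ U ∈ 𝒰, x ∈ U)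
    (hmesh : ∀ U ∈ 𝒰, ∀ x ∈ U, ∀ y ∈ U, dynMetric α dist A x y ≤ ε)
    (hord : ∀ x : X, {U : Set X | U ∈ 𝒰 ∧ x ∈ U}.ncard ≤ n + 1) : Sys α ε A (n + 1) := by
  classical
  obtain ⟨f, hf⟩ := PartitionOfUnity.exists_isSubordinate (s := (Set.univ : Set X)) isClosed_univ
    (fun U : {U // U ∈ 𝒰} => (U : Set X)) (fun U => hop U U.2) (by
      intro x _
      obtain ⟨U, hU, hx⟩ := hcov x
      exact Set.mem_iUnion.2 ⟨⟨U, hU⟩, hx⟩)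
  have hmem : ∀ (U : {U // U ∈ 𝒰}) x, f U x ≠ 0 → x ∈ (U : Set X) := fun U x hx =>
    hf U (subset_tsupport _ hx)
  have hsum : ∀ x, ∑ U, f U x = 1 := fun x => by
    rw [← finsum_eq_sum_of_fintype]; exact f.sum_eq_one (Set.mem_univ x)
  refine ⟨{U // U ∈ 𝒰}, inferInstance, fun U => f U, 1, fun _ => Finset.univ,
    fun U => (f U).continuous, fun U x => f.nonneg U x, hsum, ?_, fun _ _ => hsum, ?_⟩
  · intro x
    refine le_trans ?_ (hord x)
    rw [← Set.ncard_image_of_injective _ Subtype.val_injective]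
    refine Set.ncard_le_ncard ?_ (𝒰.finite_toSet.subset fun U hU => hU.1)
    rintro _ ⟨U, hU, rfl⟩
    exact ⟨U.2, hmem U x hU⟩
  · intro s hs U _ x y hx hy
    exact dist_le_of_dynMetric (hmesh U U.2 x (hmem U x hx) y (hmem U y hy)) hs

theorem cover_nonempty {G : Type*} {X : Type u} [Group G] [MetricSpace X] [CompactSpace X]
    {α : GAction G X} (hα : ∀ g, Continuous (α.act g)) {ε : ℝ} (hε : 0 < ε) (A : Finset G) :
    {n : ℕ | ∃ 𝒰 : Finset (Set X),
    (∀ U ∈ 𝒰, IsOpen U) ∧ (∀ x : X, ∃ U ∈ 𝒰, x ∈ U) ∧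
    (∀ U ∈ 𝒰, ∀ x ∈ U, ∀ y ∈ U, dynMetric α dist A x y ≤ ε) ∧
    ∀ x : X, {U : Set X | U ∈ 𝒰 ∧ x ∈ U}.ncard ≤ n + 1}.Nonempty := by
  classical
  let V : X → Set X := fun x => ⋂ g ∈ A, (α.act g) ⁻¹' Metric.ball (α.act g x) (ε / 2)
  have hVo : ∀ x, IsOpen (V x) := fun x =>
    isOpen_biInter_finset fun g _ => Metric.isOpen_ball.preimage (hα g)
  have hVm : ∀ x, x ∈ V x := fun x => by simp [V, hε]
  obtain ⟨t, ht⟩ := isCompact_univ.elim_finite_subcover V hVo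
    (fun x _ => Set.mem_iUnion.2 ⟨x, hVm x⟩)
  refine ⟨(t.image V).card, t.image V, ?_, ?_, ?_, ?_⟩
  · intro U hU
    obtain ⟨x, _, rfl⟩ := Finset.mem_image.1 hU
    exact hVo x
  · intro x
    obtain ⟨y, hy, hx⟩ := Set.mem_iUnion₂.1 (ht (Set.mem_univ x))
    exact ⟨V y, Finset.mem_image_of_mem _ hy, hx⟩
  · intro U hU x hx y hy
    obtain ⟨z, _, rfl⟩ := Finset.mem_image.1 hU
    refine dynMetric_le hε.le fun g hg => ?_
    have h1 := Set.mem_iInter₂.1 hx g hg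
    have h2 := Set.mem_iInter₂.1 hy g hg
    simp only [Set.mem_preimage, Metric.mem_ball] at h1 h2
    have := dist_triangle_right (α.act g x) (α.act g y) (α.act g z)
    linarith
  · intro x
    have : {U : Set X | U ∈ t.image V ∧ x ∈ U} ⊆ (t.image V : Finset (Set X)) :=
      fun U hU => hU.1
    have h := Set.ncard_le_ncard this (Finset.finite_toSet _)
    rw [Set.ncard_coe_finset] at h
    omega

theorem Sys.of_widim {G : Type*} {X : Type u} [Group G] [MetricSpace X] [CompactSpace X]
    {α : GAction G X} (hα : ∀ g, Continuous (α.act g)) {ε : ℝ} (hε : 0 < ε) (A : Finset G) :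
    Sys α ε A (widim (dynMetric α dist A) ε + 1) := by
  obtain ⟨𝒰, h1, h2, h3, h4⟩ := Nat.sInf_mem (cover_nonempty hα hε A)
  exact Sys.of_cover 𝒰 h1 h2 h3 h4

theorem Sys.approx {G : Type*} {X : Type u} [Group G] [MetricSpace X] {m : ℕ}
    {α : GAction G X} {ε : ℝ} {A : Finset G} {q : ℕ} (h : Sys α ε A q)
    (hq : 2 * q ≤ m * A.card + 1) (f₀ : X → Fin m → ℝ) (η : ℝ) (hη : 0 < η)
    (hf₀ : ∀ x y, dist x y ≤ ε → dist (f₀ x) (f₀ y) ≤ η) :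
    ∃ F : G → X → Fin m → ℝ, (∀ s, Continuous (F s)) ∧
      (∀ s ∈ A, ∀ x, dist (F s x) (f₀ (α.act s x)) ≤ 2 * η) ∧
      (∀ x y, (∀ s ∈ A, F s x = F s y) → ∀ s ∈ A, dist (α.act s x) (α.act s y) ≤ ε) := by
  classical
  obtain ⟨P, i, φ, c, Ps, h1, h2, h3, h4, h5, h6⟩ := h
  rcases isEmpty_or_nonempty X with hX | hX
  · exact ⟨fun _ x => isEmptyElim x, fun _ => by
      rw [continuous_iff_continuousAt]; exact fun x => isEmptyElim x,
      fun _ _ x => isEmptyElim x, fun x => isEmptyElim x⟩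
  have hc0 : 0 ≤ c := by
    rw [← h3 hX.some]; exact Finset.sum_nonneg fun p _ => h2 p _
  let xp : P → X := fun p => if h : ∃ x, φ p x ≠ 0 then h.choose else hX.some
  have hxp : ∀ p x, φ p x ≠ 0 → φ p (xp p) ≠ 0 := by
    intro p x hx
    have h : ∃ x, φ p x ≠ 0 := ⟨x, hx⟩
    simp only [xp, dif_pos h]
    exact h.choose_spec
  let w : P → (A → Fin m → ℝ) := fun p s => if p ∈ Ps s then f₀ (α.act s (xp p)) else 0
  obtain ⟨v, hv1, hv2⟩ := exists_generic w (η / (c + 1)) (by positivity) Finset.univ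
  have hfr : Module.finrank ℝ (A → Fin m → ℝ) = m * A.card := by
    simp [Module.finrank_pi_fintype, mul_comm]
  rw [hfr] at hv2
  refine ⟨fun s x => if hs : s ∈ A then ∑ p, φ p x • v p ⟨s, hs⟩ else 0, ?_, ?_, ?_⟩
  · intro s
    by_cases hs : s ∈ A
    · simp only [hs, dif_pos]
      exact continuous_finsetSum _ fun p _ => (h1 p).smul continuous_const
    · simp only [hs, dif_neg, not_false_eq_true]
      exact continuous_const
  · intro s hs x
    simp only [hs, dif_pos]
    have e1 : ‖∑ p, φ p x • v p ⟨s, hs⟩ - ∑ p, φ p x • w p ⟨s, hs⟩‖ ≤ η := by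
      rw [← Finset.sum_sub_distrib]
      calc ‖∑ p, (φ p x • v p ⟨s, hs⟩ - φ p x • w p ⟨s, hs⟩)‖
          ≤ ∑ p, ‖φ p x • v p ⟨s, hs⟩ - φ p x • w p ⟨s, hs⟩‖ := norm_sum_le _ _
        _ ≤ ∑ p, φ p x * (η / (c + 1)) := by
          refine Finset.sum_le_sum fun p _ => ?_
          rw [← smul_sub, norm_smul, Real.norm_of_nonneg (h2 p x)]
          refine mul_le_mul_of_nonneg_left ?_ (h2 p x)
          exact (norm_le_pi_norm (v p - w p) ⟨s, hs⟩).trans (hv1 p).le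
        _ = c * (η / (c + 1)) := by rw [← Finset.sum_mul, h3]
        _ ≤ η := by
          rw [mul_div_assoc', div_le_iff₀ (by positivity)]; nlinarith
    have e2 : ∑ p, φ p x • w p ⟨s, hs⟩ = ∑ p ∈ Ps s, φ p x • f₀ (α.act s (xp p)) := by
      simp only [w, smul_ite, smul_zero]
      rw [Finset.sum_ite_mem, Finset.univ_inter]
    have e3 : ‖∑ p ∈ Ps s, φ p x • f₀ (α.act s (xp p)) - f₀ (α.act s x)‖ ≤ η := by
      have : f₀ (α.act s x) = ∑ p ∈ Ps s, φ p x • f₀ (α.act s x) := by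
        rw [← Finset.sum_smul, h5 s hs x, one_smul]
      rw [this, ← Finset.sum_sub_distrib]
      calc _ ≤ ∑ p ∈ Ps s, ‖φ p x • f₀ (α.act s (xp p)) - φ p x • f₀ (α.act s x)‖ :=
            norm_sum_le _ _
        _ ≤ ∑ p ∈ Ps s, φ p x * η := by
          refine Finset.sum_le_sum fun p hp => ?_
          rw [← smul_sub, norm_smul, Real.norm_of_nonneg (h2 p x)]
          by_cases h0 : φ p x = 0
          · simp [h0]
          · refine mul_le_mul_of_nonneg_left ?_ (h2 p x)
            rw [← dist_eq_norm]
            exact hf₀ _ _ (h6 s hs p hp _ _ (hxp p x h0) h0)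
        _ = η := by rw [← Finset.sum_mul, h5 s hs x, one_mul]
    rw [e2] at e1
    rw [dist_eq_norm]
    calc _ ≤ _ := norm_sub_le_norm_sub_add_norm_sub _ _ _
      _ ≤ 2 * η := by linarith
  · intro x y hxy s hs
    let T : Finset P := Finset.univ.filter (fun p => φ p x ≠ 0) ∪
      Finset.univ.filter (fun p => φ p y ≠ 0)
    have hcnt : ∀ z, (Finset.univ.filter (fun p => φ p z ≠ 0)).card ≤ q := by
      intro z
      have := h4 z
      rw [← Set.ncard_coe_finset]
      simpa using this
    have hTc : T.card ≤ m * A.card + 1 := by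
      have := Finset.card_union_le (Finset.univ.filter (fun p => φ p x ≠ 0))
        (Finset.univ.filter (fun p => φ p y ≠ 0))
      have := hcnt x
      have := hcnt y
      show (_ ∪ _ : Finset P).card ≤ _
      omega
    have hout : ∀ p, p ∉ T → φ p x - φ p y = 0 := by
      intro p hp
      simp only [T, Finset.mem_union, Finset.mem_filter, Finset.mem_univ, true_and, not_or,
        not_not] at hp
      rw [hp.1, hp.2, sub_zero]
    have k1 : ∑ p ∈ T, (φ p x - φ p y) = 0 := by
      rw [Finset.sum_subset (Finset.subset_univ T) (fun p _ hp => hout p hp),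
        Finset.sum_sub_distrib, h3, h3, sub_self]
    have k2 : ∑ p ∈ T, (φ p x - φ p y) • v p = 0 := by
      rw [Finset.sum_subset (Finset.subset_univ T) (fun p _ hp => by rw [hout p hp, zero_smul])]
      simp_rw [sub_smul]
      rw [Finset.sum_sub_distrib, sub_eq_zero]
      funext s
      have := hxy s s.2
      simp only [s.2, dif_pos] at this
      simpa [Finset.sum_apply] using this
    have k3 := hv2 T _ (Finset.subset_univ T) hTc k1 k2
    obtain ⟨p, hp, hpx⟩ : ∃ p ∈ Ps s, φ p x ≠ 0 := by
      by_contra hcon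
      push Not at hcon
      have := h5 s hs x
      rw [Finset.sum_eq_zero hcon] at this
      exact zero_ne_one this
    have hpT : p ∈ T := Finset.mem_union_left _ (by simp [hpx])
    have := k3 p hpT
    exact h6 s hs p hp x y hpx (by rw [← sub_eq_zero.1 this]; exact hpx)

theorem eq_univ_of_inv {G : Type*} [Group G] [Fintype G] {S : Finset G} (hS : S.Nonempty)
    (h : IsFolnerInv Finset.univ (1 / (2 * (Fintype.card G : ℝ))) S) : S = Finset.univ := by
  classical
  rw [isFolnerInv_iff] at h
  have h1 : (Finset.univ : Finset G) * S = Finset.univ := by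
    obtain ⟨s, hs⟩ := hS
    refine Finset.eq_univ_iff_forall.2 fun g => ?_
    exact Finset.mem_mul.2 ⟨g * s⁻¹, Finset.mem_univ _, s, hs, by simp⟩
  rw [h1] at h
  have hpos : (0 : ℝ) < Fintype.card G := by exact_mod_cast Fintype.card_pos
  have h2 : (S.card : ℝ) ≤ Fintype.card G := by exact_mod_cast Finset.card_le_univ S
  have h3 : ((Finset.univ \ S).card : ℝ) ≤ 1 / 2 := by
    refine h.trans ?_
    rw [one_div_mul_eq_div, div_le_div_iff₀ (by positivity) (by norm_num)]
    linarith
  have h4 : (Finset.univ \ S).card = 0 := by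
    have : ((Finset.univ \ S).card : ℝ) < 1 := by linarith
    have : (Finset.univ \ S).card < 1 := by exact_mod_cast this
    omega
  rw [Finset.card_eq_zero, Finset.sdiff_eq_empty_iff_subset] at h4
  exact Finset.univ_subset_iff.1 h4

theorem card_large {G : Type*} [Group G] [Infinite G] {Fseq : ℕ → Finset G}
    (hF : IsFolnerSeq Fseq) (B : ℕ) : ∃ N, ∀ n ≥ N, B ≤ (Fseq n).card := by
  classical
  obtain ⟨K, hK⟩ := Infinite.exists_subset_card_eq G (2 * B)
  obtain ⟨N, hN⟩ := hF.2 K 1 one_pos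
  refine ⟨N, fun n hn => ?_⟩
  have h := hN n hn
  rw [isFolnerInv_iff, one_mul] at h
  have h1 : ((K * Fseq n) \ Fseq n).card ≤ (Fseq n).card := by exact_mod_cast h
  have h2 : K.card ≤ (K * Fseq n).card := Finset.card_le_card_mul_right (hF.1 n)
  have h3 := Finset.le_card_sdiff (Fseq n) (K * Fseq n)
  omega

theorem exists_sys {G : Type*} {X : Type u} [Group G] [MetricSpace X] [CompactSpace X] (m : ℕ)
    (Fseq : ℕ → Finset G) (hFseq : IsFolnerSeq Fseq)
    (α : GAction G X) (hα : ∀ g, Continuous (α.act g))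
    (hmdim : mdim α dist Fseq < (m : ℝ≥0∞) / 2) (ε : ℝ) (hε : 0 < ε) :
    ∃ (K : Finset G) (δ : ℝ), 0 < δ ∧ ∀ S : Finset G, S.Nonempty → IsFolnerInv K δ S →
      ∃ q, Sys α ε S q ∧ 2 * q ≤ m * S.card + 1 := by
  classical
  have h1 : mdimEps α dist Fseq ε < (m : ℝ≥0∞) / 2 :=
    lt_of_le_of_lt (le_iSup₂ (f := fun (ε : ℝ) (_ : 0 < ε) => mdimEps α dist Fseq ε) ε hε) hmdim
  obtain ⟨θ, hθ1, hθ2⟩ := ENNReal.lt_iff_exists_nnreal_btwn.1 h1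
  have hθm : (θ : ℝ) < m / 2 := by
    have h2 : ((m : ℝ≥0∞) / 2) = (((m : NNReal) / 2 : NNReal) : ℝ≥0∞) := by
      rw [ENNReal.coe_div two_ne_zero]; simp
    rw [h2, ENNReal.coe_lt_coe] at hθ2
    have : ((θ : NNReal) : ℝ) < (((m : NNReal) / 2 : NNReal) : ℝ) := by exact_mod_cast hθ2
    simpa using this
  have hev := Filter.eventually_lt_of_limsup_lt hθ1
  obtain ⟨M, hM⟩ := Filter.eventually_atTop.1 hev
  have hw : ∀ n ≥ M, (widim (dynMetric α dist (Fseq n)) ε : ℝ) ≤ θ * (Fseq n).card := by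
    intro n hn
    have h := (hM n hn).le
    have hpos : (Fseq n).card ≠ 0 := (hFseq.1 n).card_pos.ne'
    rw [ENNReal.div_le_iff (by exact_mod_cast hpos) (by simp)] at h
    exact_mod_cast h
  cases finite_or_infinite G with
  | inl hfin =>
    have := Fintype.ofFinite G
    have hpos : (0 : ℝ) < Fintype.card G := by exact_mod_cast Fintype.card_pos
    obtain ⟨N, hN⟩ := hFseq.2 Finset.univ (1 / (2 * (Fintype.card G : ℝ))) (by positivity)
    refine ⟨Finset.univ, 1 / (2 * (Fintype.card G : ℝ)), by positivity, fun S hS hinv => ?_⟩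
    have hSF : S = Fseq (max M N) := by
      rw [eq_univ_of_inv hS hinv, eq_univ_of_inv (hFseq.1 _) (hN _ (le_max_right M N))]
    have hwn := hw _ (le_max_left M N)
    rw [← hSF] at hwn
    refine ⟨_, Sys.of_widim hα hε S, ?_⟩
    have hSpos : (0 : ℝ) < S.card := by exact_mod_cast hS.card_pos
    have : (2 * widim (dynMetric α dist S) ε : ℝ) < m * S.card := by nlinarith
    have : 2 * widim (dynMetric α dist S) ε < m * S.card := by exact_mod_cast this
    omega
  | inr hinf =>
    have hne : ∀ A : Finset G, ∃ q, Sys α ε A q := fun A => ⟨_, Sys.of_widim hα hε A⟩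
    let H : Finset G → ℕ := fun A => sInf {q | Sys α ε A q}
    have hHmem : ∀ A, Sys α ε A (H A) := fun A => Nat.sInf_mem (hne A)
    have hHle : ∀ A q, Sys α ε A q → H A ≤ q := fun A q h => Nat.sInf_le h
    have hHe : H ∅ = 0 := Nat.le_zero.1 (hHle _ _ Sys.empty)
    have hsub : ∀ A B, H (A ∪ B) ≤ H A + H B := fun A B => hHle _ _ ((hHmem A).union (hHmem B))
    have htr : ∀ A c, H (A * {c}) ≤ H A := fun A c => hHle _ _ ((hHmem A).translate hα c)
    have hC : ∀ A : Finset G, H A ≤ H {1} * A.card := by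
      intro A
      induction A using Finset.induction_on with
      | empty => simp [hHe]
      | insert a A ha ih =>
        rw [Finset.insert_eq, Finset.card_union_of_disjoint (by simpa using ha),
          Finset.card_singleton]
        have h1 := hsub {a} A
        have h2 := htr {1} a
        rw [Finset.singleton_mul_singleton, one_mul] at h2
        nlinarith
    set r := ((m : ℝ) / 2 - θ) / 2 with hr
    have hrpos : 0 < r := by rw [hr]; linarith
    obtain ⟨B, hB⟩ := exists_nat_gt (1 / r)
    obtain ⟨N, hN⟩ := card_large hFseq B
    obtain ⟨K, δ, hδ, hK⟩ := ornstein_weiss (fun A => (H A : ℝ)) (by exact_mod_cast hHe)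
      (by exact_mod_cast hsub) (by exact_mod_cast htr) (H {1}) (by exact_mod_cast hC)
      Fseq hFseq (θ + r) (by positivity) (max M N) (by
        intro n hn
        have e1 := hw n (le_trans (le_max_left _ _) hn)
        have e2 := hN n (le_trans (le_max_right _ _) hn)
        have e3 : (H (Fseq n) : ℝ) ≤ widim (dynMetric α dist (Fseq n)) ε + 1 := by
          exact_mod_cast hHle _ _ (Sys.of_widim hα hε (Fseq n))
        have e4 : (B : ℝ) ≤ (Fseq n).card := by exact_mod_cast e2
        have e5 : 1 ≤ r * (Fseq n).card := by
          have : 1 / r ≤ (Fseq n).card := by linarith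
          rw [div_le_iff₀ hrpos] at this
          linarith
        show (H (Fseq n) : ℝ) ≤ (θ + r) * (Fseq n).card
        linarith) (m / 2) (by rw [hr]; linarith)
    refine ⟨K, δ, hδ, fun S _ hinv => ⟨H S, hHmem S, ?_⟩⟩
    have h := hK S hinv
    have h' : (2 * H S : ℝ) ≤ m * S.card := by
      have : (H S : ℝ) ≤ m / 2 * S.card := h
      linarith
    have : 2 * H S ≤ m * S.card := by exact_mod_cast h'
    omega

/-- the set of functions that separate points at distance `≥ ε` in the fibres of `π` -/
def SepSet {G X Y : Type*} [Group G] [MetricSpace X] (α : GAction G X) (π : X → Y) (m : ℕ)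
    (ε : ℝ) : Set C(X, Fin m → ℝ) :=
  {f | ∀ x y, π x = π y → (∀ g, f (α.act g x) = f (α.act g y)) → dist x y < ε}

theorem isOpen_sepSet {G X Y : Type*} [Group G] [MetricSpace X] [CompactSpace X]
    [TopologicalSpace Y] [T2Space Y] (α : GAction G X)
    (hα : ∀ g, Continuous (α.act g)) (π : X → Y) (hπ : Continuous π) (m : ℕ)
    (ε : ℝ) : IsOpen (SepSet α π m ε) := by
  rw [← isClosed_compl_iff]
  let C : Set (C(X, Fin m → ℝ) × (X × X)) :=
    {p | π p.2.1 = π p.2.2} ∩ ({p | ε ≤ dist p.2.1 p.2.2} ∩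
      ⋂ g, {p | p.1 (α.act g p.2.1) = p.1 (α.act g p.2.2)})
  have hC : IsClosed C := by
    refine (isClosed_eq ?_ ?_).inter ((isClosed_le ?_ ?_).inter
      (isClosed_iInter fun g => isClosed_eq ?_ ?_))
    · exact hπ.comp (continuous_fst.comp continuous_snd)
    · exact hπ.comp (continuous_snd.comp continuous_snd)
    · exact continuous_const
    · exact (continuous_fst.comp continuous_snd).dist (continuous_snd.comp continuous_snd)
    · have h2 := (hα g).comp (continuous_fst.comp
        (continuous_snd (X := C(X, Fin m → ℝ)) (Y := X × X)))
      exact continuous_fst.eval h2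
    · have h2 := (hα g).comp (continuous_snd.comp
        (continuous_snd (X := C(X, Fin m → ℝ)) (Y := X × X)))
      exact continuous_fst.eval h2
  have : (SepSet α π m ε)ᶜ = Prod.fst '' C := by
    ext f
    simp only [SepSet, Set.mem_compl_iff, Set.mem_setOf_eq, Set.mem_image]
    push Not
    constructor
    · rintro ⟨x, y, h1, h2, h3⟩
      exact ⟨(f, x, y), ⟨h1, h3, Set.mem_iInter.2 h2⟩, rfl⟩
    · rintro ⟨⟨f', x, y⟩, ⟨h1, h3, h2⟩, rfl⟩
      exact ⟨x, y, h1, Set.mem_iInter.1 h2, h3⟩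
  rw [this]
  exact isClosedMap_fst_of_compactSpace _ hC

theorem dense_sepSet {G Y : Type*} {X : Type u} [Group G] [MetricSpace X] [CompactSpace X]
    [TopologicalSpace Y] (m : ℕ)
    (Fseq : ℕ → Finset G) (hFseq : IsFolnerSeq Fseq)
    (α : GAction G X) (hα : ∀ g, Continuous (α.act g))
    (β : GAction G Y) (hβ : ∀ g, Continuous (β.act g)) (hAF : IsAlmostFinite β)
    (π : X → Y) (hπ : Continuous π) (hπe : ∀ g x, π (α.act g x) = β.act g (π x))
    (hmdim : mdim α dist Fseq < (m : ℝ≥0∞) / 2) (ε : ℝ) (hε : 0 < ε) :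
    Dense (SepSet α π m ε) := by
  classical
  rw [Metric.dense_iff]
  intro f₀ r hr
  obtain ⟨δ₀, hδ₀, hf₀⟩ := Metric.uniformContinuous_iff.1
    (CompactSpace.uniformContinuous_of_continuous f₀.continuous) (r / 4) (by positivity)
  set ε' := min (ε / 2) (δ₀ / 2) with hε'
  have hε'pos : 0 < ε' := by positivity
  have hf₀' : ∀ x y, dist x y ≤ ε' → dist (f₀ x) (f₀ y) ≤ r / 4 := fun x y h =>
    (hf₀ (lt_of_le_of_lt (h.trans (min_le_right _ _)) (by linarith))).le
  obtain ⟨K, δ, hδ, hK⟩ := exists_sys m Fseq hFseq α hα hmdim ε' hε'pos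
  obtain ⟨ι, _, W, S, hW, hS, hdisj, hun⟩ := hAF K δ hδ
  have hF : ∀ i, ∃ F : G → X → Fin m → ℝ, (∀ s, Continuous (F s)) ∧
      (∀ s ∈ S i, ∀ x, dist (F s x) (f₀ (α.act s x)) ≤ 2 * (r / 4)) ∧
      (∀ x y, (∀ s ∈ S i, F s x = F s y) →
        ∀ s ∈ S i, dist (α.act s x) (α.act s y) ≤ ε') := by
    intro i
    obtain ⟨q, hq1, hq2⟩ := hK (S i) (hS i).1 (hS i).2
    exact hq1.approx hq2 f₀ (r / 4) (by positivity) hf₀'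
  choose F hFc hFa hFs using hF
  have hinv : ∀ g x, α.act g⁻¹ (α.act g x) = x := fun g x => by
    rw [← α.act_mul, inv_mul_cancel, α.act_one]
  have hinv' : ∀ g x, α.act g (α.act g⁻¹ x) = x := fun g x => by
    rw [← α.act_mul, mul_inv_cancel, α.act_one]
  have hex : ∀ y : Y, ∃ p : ι × G, p.2 ∈ S p.1 ∧ y ∈ β.act p.2 '' W p.1 := by
    intro y
    have : y ∈ (⋃ i, ⋃ s ∈ S i, β.act s '' W i) := hun ▸ Set.mem_univ y
    simp only [Set.mem_iUnion] at this
    obtain ⟨i, s, hs, h⟩ := this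
    exact ⟨(i, s), hs, h⟩
  choose e he1 he2 using hex
  have heq : ∀ y i s, s ∈ S i → y ∈ β.act s '' W i → e y = (i, s) := by
    intro y i s hs hy
    by_contra hne
    refine Set.disjoint_left.1 (hdisj (e y).1 i (e y).2 (he1 y) s hs ?_) (he2 y) hy
    rintro ⟨h1, h2⟩
    exact hne (Prod.ext h1 h2)
  have hopen : ∀ i s, IsOpen (β.act s '' W i) := by
    intro i s
    have : β.act s '' W i = β.act s⁻¹ ⁻¹' W i := by
      ext y
      constructor
      · rintro ⟨w, hw, rfl⟩
        show β.act s⁻¹ (β.act s w) ∈ W i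
        rwa [← β.act_mul, inv_mul_cancel, β.act_one]
      · intro hy
        exact ⟨_, hy, by rw [← β.act_mul, mul_inv_cancel, β.act_one]⟩
    rw [this]
    exact (hW i).isOpen.preimage (hβ _)
  let f : X → Fin m → ℝ := fun z => F (e (π z)).1 (e (π z)).2 (α.act (e (π z)).2⁻¹ z)
  have hfeq : ∀ z i s, s ∈ S i → π z ∈ β.act s '' W i → f z = F i s (α.act s⁻¹ z) := by
    intro z i s hs hz
    simp only [f, heq _ i s hs hz]
  have hfc : Continuous f := by
    rw [continuous_iff_continuousAt]
    intro z
    have hcont : Continuous fun z' =>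
        F (e (π z)).1 (e (π z)).2 (α.act (e (π z)).2⁻¹ z') := (hFc _ _).comp (hα _)
    refine hcont.continuousAt.congr ?_
    have hnhd : π ⁻¹' (β.act (e (π z)).2 '' W (e (π z)).1) ∈ nhds z :=
      ((hopen _ _).preimage hπ).mem_nhds (he2 _)
    filter_upwards [hnhd] with z' hz'
    exact (hfeq z' _ _ (he1 _) hz').symm
  refine ⟨⟨f, hfc⟩, ?_, ?_⟩
  · rw [Metric.mem_ball]
    refine lt_of_le_of_lt ((ContinuousMap.dist_le (C := r / 2) (by positivity)).2 fun z => ?_)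
      (by linarith)
    have := hFa _ _ (he1 (π z)) (α.act (e (π z)).2⁻¹ z)
    rw [hinv'] at this
    show dist (f z) (f₀ z) ≤ r / 2
    simp only [f]
    linarith
  · intro x y hxy hg
    have hs := he1 (π x)
    have hm := he2 (π x)
    generalize e (π x) = p at hs hm
    obtain ⟨i, s⟩ := p
    simp only at hs hm
    obtain ⟨w, hw, hwx⟩ := hm
    have hπx : ∀ z, π z = π x → ∀ t, π (α.act t (α.act s⁻¹ z)) = β.act t w := by
      intro z hz t
      rw [hπe, hπe, hz, ← hwx, ← β.act_mul s⁻¹, inv_mul_cancel, β.act_one]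
    have hft : ∀ z, π z = π x → ∀ t ∈ S i,
        f (α.act t (α.act s⁻¹ z)) = F i t (α.act s⁻¹ z) := by
      intro z hz t ht
      rw [hfeq _ i t ht (by rw [hπx z hz t]; exact ⟨w, hw, rfl⟩), hinv]
    have := hFs i (α.act s⁻¹ x) (α.act s⁻¹ y) (fun t ht => by
      rw [← hft x rfl t ht, ← hft y hxy.symm t ht, ← α.act_mul, ← α.act_mul]
      exact hg _) s hs
    rw [hinv', hinv'] at this
    have h2 : ε' ≤ ε / 2 := min_le_left _ _
    linarith

theorem exists_sep {G Y : Type*} {X : Type u} [Group G] [MetricSpace X] [CompactSpace X]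
    [TopologicalSpace Y] [T2Space Y] (m : ℕ)
    (Fseq : ℕ → Finset G) (hFseq : IsFolnerSeq Fseq)
    (α : GAction G X) (hα : ∀ g, Continuous (α.act g))
    (β : GAction G Y) (hβ : ∀ g, Continuous (β.act g)) (hAF : IsAlmostFinite β)
    (π : X → Y) (hπ : Continuous π) (hπe : ∀ g x, π (α.act g x) = β.act g (π x))
    (hmdim : mdim α dist Fseq < (m : ℝ≥0∞) / 2) :
    ∃ f : X → Fin m → ℝ, Continuous f ∧
      ∀ x y, π x = π y → (∀ g, f (α.act g x) = f (α.act g y)) → x = y := by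
  have hd : Dense (⋂ n : ℕ, SepSet α π m (1 / ((n : ℝ) + 1))) :=
    dense_iInter_of_isOpen_nat (fun n => isOpen_sepSet α hα π hπ m _) fun n =>
      dense_sepSet m Fseq hFseq α hα β hβ hAF π hπ hπe hmdim _ Nat.one_div_pos_of_nat
  obtain ⟨f, hf⟩ := hd.nonempty
  refine ⟨f, f.continuous, fun x y hxy hg => ?_⟩
  by_contra hne
  obtain ⟨n, hn⟩ := exists_nat_one_div_lt (dist_pos.2 hne)
  have := Set.mem_iInter.1 hf n x y hxy hg
  linarith

/-- squeeze the reals into `(0,1)` -/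
noncomputable def squeeze (t : ℝ) : ℝ := Real.arctan t / Real.pi + 1 / 2

theorem squeeze_pos (t : ℝ) : 0 < squeeze t := by
  unfold squeeze
  have h := Real.neg_pi_div_two_lt_arctan t
  have := Real.pi_pos
  have : -(1 / 2) < Real.arctan t / Real.pi := by
    rw [lt_div_iff₀ this]; linarith
  linarith

theorem squeeze_lt (t : ℝ) : squeeze t < 1 := by
  unfold squeeze
  have h := Real.arctan_lt_pi_div_two t
  have := Real.pi_pos
  have : Real.arctan t / Real.pi < 1 / 2 := by
    rw [div_lt_iff₀ this]; linarith
  linarith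

theorem squeeze_inj {s t : ℝ} (h : squeeze s = squeeze t) : s = t := by
  unfold squeeze at h
  have := Real.pi_pos
  apply Real.arctan_injective
  have h' : Real.arctan s / Real.pi = Real.arctan t / Real.pi := by linarith
  field_simp at h'
  exact h'

theorem squeeze_continuous : Continuous squeeze :=
  (Real.continuous_arctan.div_const _).add continuous_const

theorem digit_inj {a b : ℕ} {s t : ℝ} (hs0 : 0 < s) (hs : s < 1) (ht0 : 0 < t) (ht : t < 1)
    (h : (a : ℝ) + s = b + t) : a = b ∧ s = t := by
  have hab : a = b := by
    have h1 : (a : ℝ) < b + 1 := by linarith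
    have h2 : (b : ℝ) < a + 1 := by linarith
    have h1' : a < b + 1 := by exact_mod_cast h1
    have h2' : b < a + 1 := by exact_mod_cast h2
    omega
  refine ⟨hab, ?_⟩
  subst hab
  linarith

theorem stmt16 {G X Y : Type*} [Group G] [Countable G] [MetricSpace X] [CompactSpace X]
    [TopologicalSpace Y] [CompactSpace Y] [TopologicalSpace.MetrizableSpace Y]
    [TotallyDisconnectedSpace Y] (m ℓ : ℕ) (hm : 1 ≤ m) (hℓ : 2 ≤ ℓ)
    (Fseq : ℕ → Finset G) (hFseq : IsFolnerSeq Fseq)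
    (α : GAction G X) (hα : ∀ g, Continuous (α.act g))
    (β : GAction G Y) (hβ : ∀ g, Continuous (β.act g)) (hAF : IsAlmostFinite β)
    (ψ : Y → G → Fin ℓ) (hψ : Topology.IsEmbedding ψ)
    (hψe : ∀ (g : G) (y : Y) (h : G), ψ (β.act g y) h = ψ y (g⁻¹ * h))
    (π : X → Y) (hπ : Continuous π) (hπs : Function.Surjective π)
    (hπe : ∀ g x, π (α.act g x) = β.act g (π x))
    (hmdim : mdim α dist Fseq < (m : ℝ≥0∞) / 2) :
    ∃ Φ : X → G → Fin m → unitInterval, Continuous Φ ∧ Function.Injective Φ ∧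
      ∀ (g : G) (x : X) (h : G), Φ (α.act g x) h = Φ x (g⁻¹ * h) := by
  obtain ⟨f, hfc, hf⟩ := exists_sep m Fseq hFseq α hα β hβ hAF π hπ hπe hmdim
  have hℓpos : (0 : ℝ) < ℓ := by
    have : 0 < ℓ := by omega
    exact_mod_cast this
  let d : X → ℕ := fun x => (ψ (π x) 1 : Fin ℓ)
  let u : X → Fin m → ℝ := fun x i => ((d x : ℝ) + squeeze (f x i)) / ℓ
  have hu : ∀ x i, u x i ∈ unitInterval := by
    intro x i
    have h1 := squeeze_pos (f x i)
    have h2 := squeeze_lt (f x i)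
    refine ⟨by positivity, ?_⟩
    show ((d x : ℝ) + squeeze (f x i)) / ℓ ≤ 1
    rw [div_le_one hℓpos]
    have : d x + 1 ≤ ℓ := (ψ (π x) 1 : Fin ℓ).2
    have : (d x : ℝ) + 1 ≤ ℓ := by exact_mod_cast this
    linarith
  have hdc : Continuous fun x => (d x : ℝ) := by
    have h1 : Continuous fun x => ψ (π x) 1 :=
      (continuous_apply 1).comp (hψ.continuous.comp hπ)
    exact (continuous_of_discreteTopology (f := fun k : Fin ℓ => ((k : ℕ) : ℝ))).comp h1
  have huc : ∀ i, Continuous fun x => u x i := fun i =>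
    (hdc.add (squeeze_continuous.comp ((continuous_apply i).comp hfc))).div_const _
  have hsplit : ∀ x y i, u x i = u y i → d x = d y ∧ f x i = f y i := by
    intro x y i h
    have h' : ((d x : ℝ) + squeeze (f x i)) = ((d y : ℝ) + squeeze (f y i)) := by
      have h2 : ((d x : ℝ) + squeeze (f x i)) / ℓ = ((d y : ℝ) + squeeze (f y i)) / ℓ := h
      exact (div_left_inj' hℓpos.ne').1 h2
    obtain ⟨h1, h2⟩ := digit_inj (squeeze_pos _) (squeeze_lt _) (squeeze_pos _) (squeeze_lt _) h'
    exact ⟨h1, squeeze_inj h2⟩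
  refine ⟨fun x h i => ⟨u (α.act h⁻¹ x) i, hu _ i⟩, ?_, ?_, ?_⟩
  · refine continuous_pi fun h => continuous_pi fun i => ?_
    exact ((huc i).comp (hα h⁻¹)).subtype_mk _
  · intro x y hxy
    have hall : ∀ g i, u (α.act g x) i = u (α.act g y) i := by
      intro g i
      have := congrArg Subtype.val (congrFun (congrFun hxy g⁻¹) i)
      simpa using this
    apply hf
    · apply hψ.injective
      funext h
      have h1 := (hsplit _ _ ⟨0, hm⟩ (hall h⁻¹ ⟨0, hm⟩)).1
      have h2 : ∀ z, d (α.act h⁻¹ z) = (ψ (π z) h : Fin ℓ) := by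
        intro z
        show ((ψ (π (α.act h⁻¹ z)) 1 : Fin ℓ) : ℕ) = _
        rw [hπe, hψe]
        simp
      rw [h2, h2] at h1
      exact Fin.ext h1
    · intro g
      funext i
      exact (hsplit _ _ i (hall g i)).2
  · intro g x h
    funext i
    apply Subtype.ext
    show u (α.act h⁻¹ (α.act g x)) i = u (α.act (g⁻¹ * h)⁻¹ x) i
    rw [← α.act_mul]
    simp
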